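/- In any tournament on n players with n a power of two, every player of maximum out-degree (i.e., every member of the Copeland set) is an SE winner. -/

import Mathlib

/-- A tournament relation on `V`: irreflexive, asymmetric, and total. -/
structure IsTournament {V : Type*} (beats : V → V → Prop) : Prop where
  irrefl : ∀ v, ¬ beats v v
  asymm : ∀ u v, beats u v → ¬ beats v u
  total : ∀ u v, u ≠ v → beats u v ∨ beats v u

/-- `SEWinner beats S v` : the player `v` can win a balanced single-elimination
tournament among the players of `S` under some seeding.  Either `S = {v}`, or `S`
can be partitioned into pairs (via a fixed-point-free involution `f` of `S`) such
that `v` is an SE winner of the set `W` of winners of the pairs. -/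
inductive SEWinner {V : Type*} (beats : V → V → Prop) : Finset V → V → Prop
  | single (v : V) : SEWinner beats {v} v
  | round (S W : Finset V) (f : V → V) (v : V)
      (hf : ∀ x ∈ S, f x ∈ S ∧ f x ≠ x ∧ f (f x) = x)
      (hW : ∀ x, x ∈ W ↔ x ∈ S ∧ beats x (f x))
      (hw : SEWinner beats W v) : SEWinner beats S v

/-- A king: every other player is beaten by `v` or by someone `v` beats. -/
def IsKing {V : Type*} (beats : V → V → Prop) (v : V) : Prop :=
  ∀ u, u ≠ v → beats v u ∨ ∃ w, beats v w ∧ beats w u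

/-- A 3-king: every other player is reachable from `v` in at most 3 steps. -/
def IsThreeKing {V : Type*} (beats : V → V → Prop) (v : V) : Prop :=
  ∀ u, u ≠ v → beats v u ∨ (∃ w, beats v w ∧ beats w u) ∨
    ∃ w x, beats v w ∧ beats w x ∧ beats x u

/-- The out-degree of a player. -/
noncomputable def outDeg {V : Type*} [Fintype V] (beats : V → V → Prop) (v : V) : ℕ :=
  {u | beats v u}.ncard

/-- The number of directed `k`-paths originating at `v`. -/
noncomputable def kPathCount {V : Type*} [Fintype V] (beats : V → V → Prop) (k : ℕ) (v : V) : ℕ :=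
  {p : Fin (k + 1) → V | Function.Injective p ∧ p 0 = v ∧
    ∀ i : Fin k, beats (p i.castSucc) (p i.succ)}.ncard

/-- A superking: a king `v` such that every player beating `v` is beaten by at
least `log₂ n` players whom `v` beats. -/
def IsSuperking {V : Type*} [Fintype V] (beats : V → V → Prop) (v : V) : Prop :=
  IsKing beats v ∧ ∀ u, beats u v →
    Real.logb 2 (Fintype.card V) ≤ ({w | beats v w ∧ beats w u}.ncard : ℝ)

inductive Rd {V : Type*} [DecidableEq V] (beats : V → V → Prop) : Finset V → Finset V → Prop
  | empty : Rd beats ∅ ∅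
  | cons (S W : Finset V) (x y : V) (hx : x ∉ S) (hy : y ∉ S) (hxy : x ≠ y) (hb : beats x y)
      (h : Rd beats S W) : Rd beats (insert x (insert y S)) (insert x W)

theorem Rd.sub {V : Type*} [DecidableEq V] {beats : V → V → Prop} {S W : Finset V}
    (h : Rd beats S W) : W ⊆ S := by
  induction h with
  | empty => simp
  | cons S W x y hx hy hxy hb h ih => grind

theorem Rd.card {V : Type*} [DecidableEq V] {beats : V → V → Prop} {S W : Finset V}
    (h : Rd beats S W) : 2 * W.card = S.card := by
  induction h with
  | empty => simp
  | cons S W x y hx hy hxy hb h ih =>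
    have hW := h.sub
    rw [Finset.card_insert_of_notMem (by grind), Finset.card_insert_of_notMem (by grind),
      Finset.card_insert_of_notMem (by grind)]
    omega

theorem Rd.union {V : Type*} [DecidableEq V] {beats : V → V → Prop} {S W S' W' : Finset V}
    (h : Rd beats S W) (h' : Rd beats S' W') (hd : Disjoint S S') :
    Rd beats (S ∪ S') (W ∪ W') := by
  induction h with
  | empty => simpa using h'
  | cons S W x y hx hy hxy hb h ih =>
    rw [Finset.disjoint_left] at hd ih
    rw [Finset.insert_union, Finset.insert_union, Finset.insert_union]
    refine Rd.cons _ _ _ _ (by grind) (by grind) hxy hb (ih (by grind))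

theorem Rd.fn {V : Type*} [DecidableEq V] {beats : V → V → Prop} (hT : IsTournament beats)
    {S W : Finset V} (h : Rd beats S W) :
    ∃ f : V → V, (∀ x ∈ S, f x ∈ S ∧ f x ≠ x ∧ f (f x) = x) ∧
      ∀ x, x ∈ W ↔ x ∈ S ∧ beats x (f x) := by
  induction h with
  | empty => exact ⟨id, by simp, by simp⟩
  | cons S W x y hx hy hxy hb h ih =>
    obtain ⟨f, hf, hW⟩ := ih
    have hsub := h.sub
    have hnb := hT.asymm _ _ hb
    refine ⟨fun z => if z = x then y else if z = y then x else f z, ?_, ?_⟩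
    · intro z hz
      by_cases h1 : z = x
      · subst h1; grind
      by_cases h2 : z = y
      · subst h2; grind
      have hzS : z ∈ S := by grind
      have := hf z hzS
      have h3 : f z ≠ x := by grind
      have h4 : f z ≠ y := by grind
      simp [h1, h2, h3, h4, this]
    · intro z
      by_cases h1 : z = x
      · subst h1; simp [hb]
      by_cases h2 : z = y
      · subst h2
        have : z ∉ W := fun hh => hy (hsub hh)
        simp [h1, this, hnb]
      simp [h1, h2, hW]

theorem rd_even {V : Type*} [DecidableEq V] {beats : V → V → Prop} (hT : IsTournament beats)
    (m : ℕ) : ∀ S : Finset V, S.card = 2 * m → ∃ W, Rd beats S W := by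
  induction m with
  | zero =>
    intro S hS
    have : S = ∅ := by simpa using hS
    subst this
    exact ⟨∅, Rd.empty⟩
  | succ m ih =>
    intro S hS
    obtain ⟨x, hx, y, hy, hxy⟩ := Finset.one_lt_card.1 (show 1 < S.card by omega)
    have hc : ((S.erase x).erase y).card = 2 * m := by
      rw [Finset.card_erase_of_mem (by grind), Finset.card_erase_of_mem hx]; omega
    obtain ⟨W, hW⟩ := ih _ hc
    rcases hT.total x y hxy with hb | hb
    · refine ⟨insert x W, ?_⟩
      have := Rd.cons _ _ x y (by grind) (by grind) hxy hb hW
      rwa [show insert x (insert y ((S.erase x).erase y)) = S by grind] at this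
    · refine ⟨insert y W, ?_⟩
      have := Rd.cons _ _ y x (by grind) (by grind) hxy.symm hb hW
      rwa [show insert y (insert x ((S.erase x).erase y)) = S by grind] at this

theorem rd_matching {V : Type*} [DecidableEq V] {beats : V → V → Prop}
    (m : ℕ) : ∀ A B : Finset V, A.card = m → Disjoint A B →
      ∃ AM BM, AM ⊆ A ∧ BM ⊆ B ∧ AM.card = BM.card ∧ Rd beats (AM ∪ BM) AM ∧
        ∀ a ∈ A, a ∉ AM → ∀ b ∈ B, b ∉ BM → ¬ beats a b := by
  induction m with
  | zero =>
    intro A B hA hd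
    have : A = ∅ := by simpa using hA
    subst this
    exact ⟨∅, ∅, by simp, by simp, rfl, by simpa using Rd.empty, by simp⟩
  | succ m ih =>
    intro A B hA hd
    by_cases hex : ∃ a ∈ A, ∃ b ∈ B, beats a b
    · obtain ⟨a, ha, b, hb, hab⟩ := hex
      rw [Finset.disjoint_left] at hd
      obtain ⟨AM, BM, h1, h2, h3, h4, h5⟩ := ih (A.erase a) (B.erase b)
        (by rw [Finset.card_erase_of_mem ha]; omega)
        (by rw [Finset.disjoint_left]; grind)
      refine ⟨insert a AM, insert b BM, by grind, by grind, ?_, ?_, by grind⟩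
      · rw [Finset.card_insert_of_notMem (by grind), Finset.card_insert_of_notMem (by grind), h3]
      · have := Rd.cons _ _ a b (by grind) (by grind) (by grind) hab h4
        rwa [show insert a (insert b (AM ∪ BM)) = insert a AM ∪ insert b BM by grind] at this
    · exact ⟨∅, ∅, by simp, by simp, rfl, by simpa using Rd.empty, by grind⟩

theorem rd_rest {V : Type*} [DecidableEq V] {beats : V → V → Prop} (hT : IsTournament beats)
    (R Q : Finset V) (hd : Disjoint R Q) (he : (R.card + Q.card) % 2 = 0)
    (hb : ∀ r ∈ R, ∀ q ∈ Q, beats q r) :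
    ∃ WR WQ, WR ⊆ R ∧ WQ ⊆ Q ∧ Rd beats (R ∪ Q) (WR ∪ WQ) ∧ WR.card = R.card / 2 := by
  by_cases h : R.card % 2 = 0
  · obtain ⟨WR, h1⟩ := rd_even hT (R.card / 2) R (by omega)
    obtain ⟨WQ, h2⟩ := rd_even hT (Q.card / 2) Q (by omega)
    have := h1.card
    exact ⟨WR, WQ, h1.sub, h2.sub, h1.union h2 hd, by omega⟩
  · obtain ⟨r, hr⟩ := Finset.card_pos.1 (show 0 < R.card by omega)
    obtain ⟨q, hq⟩ := Finset.card_pos.1 (show 0 < Q.card by omega)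
    have hrc := Finset.card_erase_of_mem hr
    have hqc := Finset.card_erase_of_mem hq
    obtain ⟨WR, h1⟩ := rd_even hT (R.card / 2) (R.erase r) (by omega)
    obtain ⟨WQ, h2⟩ := rd_even hT (Q.card / 2) (Q.erase q) (by omega)
    have hc := h1.card
    have s1 := h1.sub
    have s2 := h2.sub
    rw [Finset.disjoint_left] at hd
    refine ⟨WR, insert q WQ, by grind, by grind, ?_, by omega⟩
    have h3 := h1.union h2 (by rw [Finset.disjoint_left]; grind)
    have := Rd.cons _ _ q r (by grind) (by grind) (by grind) (hb r hr q hq) h3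
    rwa [show insert q (insert r (R.erase r ∪ Q.erase q)) = R ∪ Q by grind,
      show insert q (WR ∪ WQ) = WR ∪ insert q WQ by grind] at this

open Classical in
theorem king_SE {V : Type*} {beats : V → V → Prop} (hT : IsTournament beats) (v : V)
    (k : ℕ) : ∀ S : Finset V, S.card = 2 ^ k → v ∈ S →
      (∀ u ∈ S, u ≠ v → beats v u ∨ ∃ w ∈ S, beats v w ∧ beats w u) →
      S.card ≤ 2 * (S.filter (beats v)).card + 1 → SEWinner beats S v := by
  induction k with
  | zero =>
    intro S hS hv _ _
    obtain ⟨w, rfl⟩ := Finset.card_eq_one.1 (by simpa using hS)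
    obtain rfl : v = w := by simpa using hv
    exact SEWinner.single v
  | succ k ih =>
    intro S hS hv hK hdeg
    set A := S.filter (beats v) with hA
    set B := (S.erase v).filter (fun u => ¬ beats v u) with hB
    have hirr := hT.irrefl v
    have hAB : Disjoint A B := by rw [Finset.disjoint_left]; grind
    have hABc : A.card + B.card + 1 = S.card := by
      rw [← Finset.card_union_of_disjoint hAB, ← Finset.card_insert_of_notMem (a := v) (by grind)]
      congr 1
      grind
    obtain ⟨AM, BM, hAM, hBM, hc, hRd, hmax⟩ :=
      rd_matching (beats := beats) A.card A B rfl hAB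
    have hBMc := Finset.card_le_card hBM
    have hAMc := Finset.card_le_card hAM
    have hp : 0 < 2 ^ k := by positivity
    rw [pow_succ] at hS
    obtain ⟨a, haA, haM⟩ := Finset.exists_mem_notMem_of_card_lt_card
      (show AM.card < A.card by omega)
    have hcR : ((A \ AM).erase a).card = A.card - AM.card - 1 := by
      rw [Finset.card_erase_of_mem (by grind), Finset.card_sdiff_of_subset hAM]
    have hcQ : (B \ BM).card = B.card - BM.card := Finset.card_sdiff_of_subset hBM
    have hd := Finset.disjoint_left.1 hAB
    obtain ⟨WR, WQ, hWR, hWQ, hrest, hWRc⟩ := rd_rest hT ((A \ AM).erase a) (B \ BM)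
      (by rw [Finset.disjoint_left]; grind) (by omega)
      (by
        intro r hr q hq
        have h1 := hmax r (by grind) (by grind) q (by grind) (by grind)
        rcases hT.total r q (by grind) with h | h
        · exact absurd h h1
        · exact h)
    have hU := hRd.union hrest (by rw [Finset.disjoint_left]; grind)
    have hF := Rd.cons _ _ v a (by grind) (by grind) (by grind) (by grind) hU
    rw [show insert v (insert a (AM ∪ BM ∪ ((A \ AM).erase a ∪ B \ BM))) = S by grind] at hF
    have hFc := hF.card
    obtain ⟨f, hf, hW⟩ := hF.fn hT
    refine SEWinner.round S _ f v hf hW (ih _ (by omega) (by simp) ?_ ?_)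
    · intro u hu huv
      by_cases hvu : beats v u
      · exact Or.inl hvu
      right
      have huQ : u ∈ B \ BM := by grind
      have huS : u ∈ S := by grind
      rcases hK u huS huv with h | ⟨w, hwS, hvw, hwu⟩
      · exact absurd h hvu
      have hwA : w ∈ A := by grind
      have hwM : w ∈ AM := by
        by_contra hcon
        exact hmax w hwA hcon u (by grind) (by grind) hwu
      exact ⟨w, by grind, hvw, hwu⟩
    · have h1 : AM.card + WR.card ≤
          ((insert v (AM ∪ (WR ∪ WQ))).filter (beats v)).card := by
        rw [← Finset.card_union_of_disjoint (by rw [Finset.disjoint_left]; grind)]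
        apply Finset.card_le_card
        intro x hx
        have : x ∈ A := by grind
        grind
      have h2 : 1 ≤ AM.card ∨ B.card = 0 := by
        by_contra hcon
        push Not at hcon
        have hAM0 : AM = ∅ := Finset.card_eq_zero.1 (by omega)
        have hBM0 : BM = ∅ := Finset.card_eq_zero.1 (by omega)
        obtain ⟨b, hb⟩ := Finset.card_pos.1 (show 0 < B.card by omega)
        rcases hK b (by grind) (by grind) with h | ⟨w, hwS, hvw, hwu⟩
        · grind
        · exact hmax w (by grind) (by grind) b hb (by grind) hwu
      omega

/-- every member of the Copeland set is an SE winner. -/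
theorem copeland_SE_winner {V : Type*} [Fintype V]
    (beats : V → V → Prop) (hT : IsTournament beats)
    (k : ℕ) (hcard : Fintype.card V = 2 ^ k)
    (v : V) (hmax : ∀ u : V, outDeg beats u ≤ outDeg beats v) :
    SEWinner beats Finset.univ v := by
  classical
  have hod : ∀ u, outDeg beats u = (Finset.univ.filter (beats u)).card := by
    intro u
    rw [outDeg, Set.ncard_eq_toFinset_card']
    congr 1
    ext; simp
  have hm : ∀ u, (Finset.univ.filter (beats u)).card ≤ (Finset.univ.filter (beats v)).card := by
    intro u
    rw [← hod, ← hod]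
    exact hmax u
  refine king_SE hT v k Finset.univ (by simpa using hcard) (by simp) ?_ ?_
  · intro u _ huv
    by_contra hcon
    push Not at hcon
    obtain ⟨h1, h2⟩ := hcon
    have huv' : beats u v := (hT.total u v huv).resolve_right h1
    have hlt : (Finset.univ.filter (beats v)).card < (Finset.univ.filter (beats u)).card := by
      apply Finset.card_lt_card
      rw [Finset.ssubset_iff_of_subset]
      · exact ⟨v, by simpa using huv', by simpa using hT.irrefl v⟩
      · intro w hw
        have hvw : beats v w := by simpa using hw
        have hne : u ≠ w := by rintro rfl; exact h1 hvw
        have := (hT.total u w hne).resolve_right (h2 w (by simp) hvw)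
        simpa using this
    exact absurd (hm u) (by omega)
  · have hio : ∀ u, (Finset.univ.filter (beats u)).card +
        (Finset.univ.filter (fun w => beats w u)).card + 1 = Fintype.card V := by
      intro u
      have hirr := hT.irrefl u
      rw [← Finset.card_union_of_disjoint, ← Finset.card_insert_of_notMem (a := u), ← Finset.card_univ]
      · congr 1
        ext w
        have := hT.total u w
        simp only [Finset.mem_insert, Finset.mem_union, Finset.mem_filter, Finset.mem_univ,
          true_and, iff_true]
        by_cases h : w = u
        · exact Or.inl h
        · exact Or.inr (this (Ne.symm h))
      · simp [hirr]
      · rw [Finset.disjoint_left]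
        intro w hw hw'
        simp only [Finset.mem_filter, Finset.mem_univ, true_and] at hw hw'
        exact hT.asymm _ _ hw hw'
    have hsum : ∑ u : V, (Finset.univ.filter (beats u)).card =
        ∑ u : V, (Finset.univ.filter (fun w => beats w u)).card := by
      simp only [Finset.card_filter]
      exact Finset.sum_comm
    have htot : ∑ u : V, (Finset.univ.filter (beats u)).card +
        ∑ u : V, (Finset.univ.filter (fun w => beats w u)).card + Fintype.card V
          = Fintype.card V * Fintype.card V := by
      have := Finset.sum_congr (rfl : (Finset.univ : Finset V) = Finset.univ) (fun u _ => hio u)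
      simpa [Finset.sum_add_distrib] using this
    have hle : ∑ u : V, (Finset.univ.filter (beats u)).card ≤
        Fintype.card V * (Finset.univ.filter (beats v)).card := by
      have := Finset.sum_le_card_nsmul (Finset.univ : Finset V)
        (fun u => (Finset.univ.filter (beats u)).card) _ (fun u _ => hm u)
      simpa using this
    have hpos : 0 < Fintype.card V := Fintype.card_pos_iff.2 ⟨v⟩
    rw [Finset.card_univ]
    refine le_of_mul_le_mul_left ?_ hpos
    rw [← hsum] at htot
    nlinarith
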